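/- Let τ be in the complex upper half-plane and let u, v ∈ ℂ with u, v ∉ ℤτ+ℤ. Then μ(u,v;τ) + e^{−2πi(u−v) − πiτ} μ(u+τ, v; τ) = −i e^{−πi(u−v) − πiτ/4}. -/

import Mathlib

open Complex Real Filter

noncomputable section

/-- The Jacobi theta function ϑ(u;τ) = Σ_{ν∈ℤ+1/2} e^{πiν²τ + 2πiν(u+1/2)}. -/
def jTheta (u τ : ℂ) : ℂ :=
  ∑' n : ℤ, Complex.exp (π * I * ((n : ℂ) + 1/2)^2 * τ + 2 * π * I * ((n : ℂ) + 1/2) * (u + 1/2))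

/-- ϑ₀(u;τ) = Σ_{n∈ℤ} e^{πin²τ + 2πinu}. -/
def jTheta0 (u τ : ℂ) : ℂ :=
  ∑' n : ℤ, Complex.exp (π * I * (n : ℂ)^2 * τ + 2 * π * I * (n : ℂ) * u)

/-- ϑ₁(u;τ) = Σ_{n∈1/2+ℤ} e^{πin²τ + 2πinu}. -/
def jTheta1 (u τ : ℂ) : ℂ :=
  ∑' n : ℤ, Complex.exp (π * I * ((n : ℂ) + 1/2)^2 * τ + 2 * π * I * ((n : ℂ) + 1/2) * u)

/-- The Dedekind eta function. -/
def dedekindEta (τ : ℂ) : ℂ :=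
  Complex.exp (π * I * τ / 12) * ∏' n : ℕ, (1 - Complex.exp (2 * π * I * ((n : ℂ) + 1) * τ))

/-- The Lerch sum μ(u,v;τ). -/
def lerchMu (u v τ : ℂ) : ℂ :=
  Complex.exp (π * I * u) / jTheta v τ *
    ∑' n : ℤ, (-1 : ℂ) ^ n * Complex.exp (π * I * ((n : ℂ)^2 + (n : ℂ)) * τ + 2 * π * I * v * (n : ℂ)) /
      (1 - Complex.exp (2 * π * I * (n : ℂ) * τ + 2 * π * I * u))

/-- a₀^{α,β}(τ). -/
def aCoef0 (α β : ℝ) (τ : ℂ) : ℂ :=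
  ∑' n : ℤ, ((n : ℂ) + (α : ℂ)/2) *
    Complex.exp (2 * π * I * (n : ℂ)^2 * τ + 2 * π * I * (n : ℂ) * ((α : ℂ) * τ + (β : ℂ)))

/-- a₁^{α,β}(τ). -/
def aCoef1 (α β : ℝ) (τ : ℂ) : ℂ :=
  ∑' n : ℤ, (((n : ℂ) + 1/2) + (α : ℂ)/2) *
    Complex.exp (2 * π * I * ((n : ℂ) + 1/2)^2 * τ + 2 * π * I * ((n : ℂ) + 1/2) * ((α : ℂ) * τ + (β : ℂ)))

/-- Finite q-Pochhammer symbol (a;q)_n. -/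
def qPochN (a q : ℂ) (n : ℕ) : ℂ := ∏ j ∈ Finset.range n, (1 - a * q ^ j)

/-- Infinite q-Pochhammer symbol (a;q)_∞. -/
def qPochInf (a q : ℂ) : ℂ := ∏' j : ℕ, (1 - a * q ^ j)

/-- The modified rank generating function R*(z;q). -/
def rankStar (z q : ℂ) : ℂ :=
  (qPochInf q q)⁻¹ * ∑' n : ℤ, (-1 : ℂ) ^ n * q ^ (n * (3 * n + 1) / 2) / (1 - z * q ^ n)

/-- The modified crank generating function C*(z;q). -/
def crankStar (z q : ℂ) : ℂ :=
  (1 - z)⁻¹ * ∏' n : ℕ, ((1 - q ^ (n + 1)) / ((1 - z * q ^ (n + 1)) * (1 - z⁻¹ * q ^ (n + 1))))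

/-- N(1,0,z;q), the overpartition-rank generating function. -/
def nGen10 (z q : ℂ) : ℂ :=
  ∑' n : ℕ, qPochN (-1) q n * q ^ (n * (n + 1) / 2) / (qPochN (z * q) q n * qPochN (z⁻¹ * q) q n)

/-- N*(1,0,z;q). -/
def nStar10 (z q : ℂ) : ℂ := nGen10 z q / (1 - z)

/-- N(1,1/q,z;q²), the M2-rank generating function for overpartitions. -/
def nGenM2over (z q : ℂ) : ℂ :=
  ∑' n : ℕ, qPochN (-1) (q^2) n * qPochN (-q) (q^2) n * q ^ n /
    (qPochN (z * q^2) (q^2) n * qPochN (z⁻¹ * q^2) (q^2) n)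

/-- N*(1,1/q,z;q²). -/
def nStarM2over (z q : ℂ) : ℂ := nGenM2over z q / (1 - z)

/-- N(0,1/q,z;q²), the M2-rank generating function for partitions without repeated odd parts. -/
def nGenM2 (z q : ℂ) : ℂ :=
  ∑' n : ℕ, qPochN (-q) (q^2) n * q ^ (n^2) /
    (qPochN (z * q^2) (q^2) n * qPochN (z⁻¹ * q^2) (q^2) n)

/-- N*(0,1/q,z;q²). -/
def nStarM2 (z q : ℂ) : ℂ := nGenM2 z q / (1 - z)

/-- The odd-rank generating function R^o(z;q). -/
def oddRank (z q : ℂ) : ℂ :=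
  (qPochInf (q^2) (q^2))⁻¹ * ∑' n : ℤ, (-1 : ℂ) ^ n * q ^ (3 * n^2 + 3 * n + 1) / (1 - z * q ^ (2 * n + 1))


/-- The reciprocal `1/(q;q)_k`, extended by zero to negative `k`. -/
def qPochInv (q : ℂ) (k : ℤ) : ℂ := if 0 ≤ k then (qPochN q q k.toNat)⁻¹ else 0

lemma qPochN_succ (a q : ℂ) (n : ℕ) : qPochN a q (n + 1) = qPochN a q n * (1 - a * q ^ n) :=
  Finset.prod_range_succ _ _

section

variable {q : ℂ}

lemma one_sub_pow_succ_ne_zero (hq : ‖q‖ < 1) (n : ℕ) : 1 - q * q ^ n ≠ 0 := by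
  intro h
  have h1 : ‖q ^ (n + 1)‖ < 1 := by
    rw [norm_pow]
    exact pow_lt_one₀ (norm_nonneg _) hq n.succ_ne_zero
  rw [pow_succ', ← sub_eq_zero.mp h, norm_one] at h1
  exact lt_irrefl _ h1

lemma qPochN_self_ne_zero (hq : ‖q‖ < 1) (n : ℕ) : qPochN q q n ≠ 0 :=
  Finset.prod_ne_zero_iff.mpr fun j _ ↦ one_sub_pow_succ_ne_zero hq j

lemma summable_norm_neg_mul_pow (hq : ‖q‖ < 1) (a : ℂ) :
    Summable fun j : ℕ ↦ ‖-(a * q ^ j)‖ := by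
  simpa [norm_mul, norm_pow] using
    (summable_geometric_of_lt_one (norm_nonneg q) hq).mul_left ‖a‖

lemma tendsto_qPochN (hq : ‖q‖ < 1) (a : ℂ) :
    Tendsto (qPochN a q) atTop (nhds (qPochInf a q)) := by
  have h := (multipliable_one_add_of_summable
    (summable_norm_neg_mul_pow hq a)).tendsto_prod_tprod_nat
  simpa only [← sub_eq_add_neg] using! h

lemma qPochInf_ne_zero (hq : ‖q‖ < 1) {a : ℂ} (ha : ∀ j : ℕ, 1 - a * q ^ j ≠ 0) :
    qPochInf a q ≠ 0 := by
  have h := tprod_one_add_ne_zero_of_summable (f := fun j : ℕ ↦ -(a * q ^ j))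
    (fun j ↦ by simpa only [← sub_eq_add_neg] using ha j) (summable_norm_neg_mul_pow hq a)
  simpa only [← sub_eq_add_neg] using! h

lemma tendsto_toNat_atTop : Tendsto Int.toNat atTop atTop :=
  tendsto_atTop_atTop.mpr fun b ↦ ⟨b, fun a ha ↦ by lia⟩

lemma qPochInv_natCast (q : ℂ) (k : ℕ) : qPochInv q k = (qPochN q q k)⁻¹ := by
  simp [qPochInv]

lemma qPochInv_of_neg {k : ℤ} (hk : k < 0) : qPochInv q k = 0 :=
  if_neg (not_le.mpr hk)

lemma qPochInv_eq_mul (hq : ‖q‖ < 1) (hq0 : q ≠ 0) (k : ℤ) :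
    qPochInv q k = (1 - q * q ^ k) * qPochInv q (k + 1) := by
  rcases lt_trichotomy k (-1) with hk | rfl | hk
  · rw [qPochInv_of_neg (by lia), qPochInv_of_neg (by lia), mul_zero]
  · simp [qPochInv, hq0]
  · lift k to ℕ using by lia
    rw [qPochInv_natCast, ← Nat.cast_succ, qPochInv_natCast, qPochN_succ, zpow_natCast]
    have h1 := one_sub_pow_succ_ne_zero hq k
    have h2 := qPochN_self_ne_zero hq k
    field_simp

lemma tendsto_qPochInv (hq : ‖q‖ < 1) :
    Tendsto (qPochInv q) atTop (nhds (qPochInf q q)⁻¹) := by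
  have h : Tendsto (fun k : ℤ ↦ (qPochN q q k.toNat)⁻¹) atTop (nhds (qPochInf q q)⁻¹) :=
    ((tendsto_qPochN hq q).inv₀ (qPochInf_ne_zero hq (one_sub_pow_succ_ne_zero hq))).comp
      tendsto_toNat_atTop
  refine h.congr' ?_
  filter_upwards [eventually_ge_atTop 0] with k hk
  exact (if_pos hk).symm

lemma exists_norm_qPochInv_le (hq : ‖q‖ < 1) : ∃ C, 0 ≤ C ∧ ∀ k, ‖qPochInv q k‖ ≤ C := by
  have h := (tendsto_qPochN hq q).inv₀ (qPochInf_ne_zero hq (one_sub_pow_succ_ne_zero hq))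
  obtain ⟨C, hC⟩ := (Metric.isBounded_range_of_tendsto _ h).exists_norm_le
  refine ⟨C, (norm_nonneg _).trans (hC _ ⟨0, rfl⟩), fun k ↦ ?_⟩
  unfold qPochInv
  split_ifs
  · exact hC _ ⟨_, rfl⟩
  · simpa using (norm_nonneg _).trans (hC _ ⟨0, rfl⟩)

/-- The finite form of the Jacobi triple product. -/
lemma hasSum_finite_triple_product (hq : ‖q‖ < 1) (hq0 : q ≠ 0) {x : ℂ} (hx : x ≠ 0) {w : ℤ → ℂ}
    (hw0 : w 0 = 1) (hw : ∀ n, w (n + 1) = -(x * q ^ n * w n)) (m : ℕ) :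
    HasSum (fun n : ℤ ↦ w n * (qPochN q q (2 * m) * (qPochInv q (m + n) * qPochInv q (m - n))))
      (qPochN x q m * qPochN (x⁻¹ * q) q m) := by
  induction m with
  | zero =>
    convert hasSum_ite_eq (0 : ℤ) (1 : ℂ) using 2 with n
    · rcases lt_trichotomy n 0 with hn | rfl | hn
      · rw [qPochInv_of_neg (k := _ + n) (by simpa using hn), if_neg hn.ne]
        simp
      · simp [hw0, qPochInv, qPochN]
      · rw [qPochInv_of_neg (k := _ - n) (by simpa using hn), if_neg hn.ne']
        simp
    · simp [qPochN]
  | succ m ih =>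
    have hl := (Equiv.subRight (1 : ℤ)).hasSum_iff.mpr ih
    have hr := (Equiv.addRight (1 : ℤ)).hasSum_iff.mpr ih
    convert! ((ih.mul_left (1 + q * q ^ (2 * m))).sub (hl.mul_left (x * q ^ m))).sub
      (hr.mul_left (x⁻¹ * q * q ^ m)) using 1
    · funext n
      have hwl : x * w (n - 1) = -(q * (q ^ n)⁻¹ * w n) := by
        have h := hw (n - 1)
        rw [sub_add_cancel, zpow_sub_one₀ hq0] at h
        rw [h]
        field_simp
      have hwr : x⁻¹ * w (n + 1) = -(q ^ n * w n) := by
        rw [hw]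
        field_simp
      simp only [Function.comp_apply, Equiv.coe_addRight, Equiv.subRight_apply]
      have e1 := qPochInv_eq_mul hq hq0 (m + n)
      have e2 := qPochInv_eq_mul hq hq0 (m - n)
      have e3 := qPochInv_eq_mul hq hq0 (m + (n - 1))
      have e4 := qPochInv_eq_mul hq hq0 (m - (n + 1))
      rw [show (m : ℤ) + (n - 1) + 1 = m + n by ring, e1] at e3
      rw [show (m : ℤ) - (n + 1) + 1 = m - n by ring, e2] at e4
      rw [e3, e4, e1, e2, show (m : ℤ) - (n - 1) = m - n + 1 by ring,
        show (m : ℤ) + (n + 1) = m + n + 1 by ring,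
        show ((m + 1 : ℕ) : ℤ) + n = m + n + 1 by push_cast; ring,
        show ((m + 1 : ℕ) : ℤ) - n = m - n + 1 by push_cast; ring,
        show 2 * (m + 1) = 2 * m + 1 + 1 by ring, qPochN_succ, qPochN_succ]
      generalize qPochInv q (m + n + 1) = s
      generalize qPochInv q (m - n + 1) = t
      generalize qPochN q q (2 * m) = P
      have hz : q ^ n ≠ 0 := zpow_ne_zero _ hq0
      rw [← mul_assoc (x * q ^ m), ← mul_assoc (x⁻¹ * q * q ^ m),
        show x * q ^ m * w (n - 1) = q ^ m * (x * w (n - 1)) by ring, hwl,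
        show x⁻¹ * q * q ^ m * w (n + 1) = q ^ m * q * (x⁻¹ * w (n + 1)) by ring, hwr]
      simp only [zpow_add₀ hq0, zpow_sub₀ hq0, zpow_natCast, zpow_one, pow_succ, pow_mul']
      field_simp
      ring
    · rw [qPochN_succ, qPochN_succ]
      field_simp
      ring

/-- A bilateral series obeying the recursion of the theta series vanishes only where one of the
factors of the Jacobi triple product does. -/
lemma tsum_theta_ne_zero (hq : ‖q‖ < 1) (hq0 : q ≠ 0) {x : ℂ} (hx : x ≠ 0) {w : ℤ → ℂ}
    (hw0 : w 0 = 1) (hw : ∀ n, w (n + 1) = -(x * q ^ n * w n)) (hs : Summable w)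
    (hxq : ∀ k : ℤ, x ≠ q ^ k) : ∑' n, w n ≠ 0 := by
  obtain ⟨C, hC0, hC⟩ := exists_norm_qPochInv_le hq
  obtain ⟨B, hB⟩ := (Metric.isBounded_range_of_tendsto _ (tendsto_qPochN hq q)).exists_norm_le
  have hlim : Tendsto (fun m : ℕ ↦ ∑' n : ℤ, w n *
      (qPochN q q (2 * m) * (qPochInv q (m + n) * qPochInv q (m - n)))) atTop
      (nhds (∑' n : ℤ, w n * (qPochInf q q * ((qPochInf q q)⁻¹ * (qPochInf q q)⁻¹)))) := by
    refine tendsto_tsum_of_dominated_convergence (hs.norm.mul_right (B * (C * C))) ?_ ?_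
    · intro n
      have h2 : Tendsto (fun m : ℕ ↦ 2 * m) atTop atTop :=
        tendsto_id.const_mul_atTop' two_pos
      exact (((tendsto_qPochN hq q).comp h2).mul
        (((tendsto_qPochInv hq).comp
          (tendsto_atTop_add_const_right _ n tendsto_natCast_atTop_atTop)).mul
        ((tendsto_qPochInv hq).comp
          (tendsto_atTop_add_const_right _ (-n) tendsto_natCast_atTop_atTop)))).const_mul (w n)
    · refine Eventually.of_forall fun m n ↦ ?_
      rw [norm_mul, norm_mul, norm_mul]
      have hB0 := (norm_nonneg _).trans (hB _ ⟨2 * m, rfl⟩)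
      gcongr
      exacts [hB _ ⟨2 * m, rfl⟩, hC _, hC _]
  simp only [(hasSum_finite_triple_product hq hq0 hx hw0 hw _).tsum_eq] at hlim
  have heq := tendsto_nhds_unique hlim ((tendsto_qPochN hq x).mul (tendsto_qPochN hq (x⁻¹ * q)))
  rw [tsum_mul_right] at heq
  refine left_ne_zero_of_mul (heq.trans_ne (mul_ne_zero ?_ ?_))
  · refine qPochInf_ne_zero hq fun j h ↦ hxq (-j) ?_
    rw [zpow_neg, zpow_natCast]
    exact eq_inv_of_mul_eq_one_left (sub_eq_zero.mp h).symm
  · refine qPochInf_ne_zero hq fun j h ↦ hxq (j + 1) ?_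
    rw [zpow_add₀ hq0, zpow_natCast, zpow_one]
    have h' := sub_eq_zero.mp h
    field_simp at h'
    rw [h', mul_comm]

end

lemma norm_exp_two_pi_I_mul_lt_one {τ : ℂ} (hτ : 0 < τ.im) : ‖cexp (2 * π * I * τ)‖ < 1 := by
  rw [Complex.norm_exp, Real.exp_lt_one_iff]
  simpa [mul_assoc] using by positivity

lemma jacobiTheta₂_term_add_one (n : ℤ) (z τ : ℂ) :
    jacobiTheta₂_term (n + 1) z τ =
      cexp (2 * π * I * z + π * I * τ) * cexp (2 * π * I * τ) ^ n * jacobiTheta₂_term n z τ := by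
  rw [jacobiTheta₂_term, jacobiTheta₂_term, ← Complex.exp_int_mul, ← Complex.exp_add,
    ← Complex.exp_add]
  congr 1
  push_cast
  ring

lemma jacobiTheta₂_ne_zero {z τ : ℂ} (hτ : 0 < τ.im)
    (hz : ∀ m n : ℤ, z + 1 / 2 + τ / 2 ≠ m * τ + n) : jacobiTheta₂ z τ ≠ 0 := by
  refine tsum_theta_ne_zero (norm_exp_two_pi_I_mul_lt_one hτ) (Complex.exp_ne_zero _)
    (x := -cexp (2 * π * I * z + π * I * τ)) (neg_ne_zero.mpr (Complex.exp_ne_zero _))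
    (by simp [jacobiTheta₂_term]) (fun n ↦ ?_)
    ((summable_jacobiTheta₂_term_iff z τ).mpr hτ) (fun k hk ↦ ?_)
  · rw [jacobiTheta₂_term_add_one]
    ring
  · rw [← Complex.exp_int_mul, ← mul_neg_one, ← Complex.exp_pi_mul_I, ← Complex.exp_add,
      Complex.exp_eq_exp_iff_exists_int] at hk
    obtain ⟨n, hn⟩ := hk
    refine hz k n ?_
    have h2 : (2 * π * I : ℂ) ≠ 0 := Complex.two_pi_I_ne_zero
    apply mul_left_cancel₀ h2
    linear_combination hn

lemma jTheta_eq (v τ : ℂ) : jTheta v τ =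
    I * cexp (π * I * τ / 4 + π * I * v) * jacobiTheta₂ (v + 1 / 2 + τ / 2) τ := by
  rw [jTheta, jacobiTheta₂, ← tsum_mul_left]
  congr 1 with n
  have hI (s : ℂ) : I * cexp s = cexp (s + π / 2 * I) := by
    rw [Complex.exp_add, Complex.exp_pi_div_two_mul_I, mul_comm]
  rw [jacobiTheta₂_term, hI, ← Complex.exp_add]
  congr 1
  ring

lemma lerchMu_eq (u v τ : ℂ) : lerchMu u v τ = cexp (π * I * u) / jTheta v τ *
    ∑' n : ℤ, jacobiTheta₂_term n (v + 1 / 2 + τ / 2) τ /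
      (1 - cexp (2 * π * I * u) * cexp (2 * π * I * τ) ^ n) := by
  rw [lerchMu]
  congr 2 with n
  congr 1
  · rw [jacobiTheta₂_term, ← Complex.exp_pi_mul_I, ← Complex.exp_int_mul, ← Complex.exp_add]
    congr 1
    ring
  · rw [← Complex.exp_int_mul, ← Complex.exp_add]
    congr 2
    ring

lemma summable_div_one_sub_mul_zpow {q a : ℂ} (hq : ‖q‖ < 1) (hq0 : q ≠ 0) (ha : a ≠ 0)
    {w : ℤ → ℂ} (hw : Summable w) : Summable fun n ↦ w n / (1 - a * q ^ n) := by
  have hpos : Tendsto (fun n : ℤ ↦ (1 - a * q ^ n)⁻¹) atTop (nhds (1 - a * 0)⁻¹) := by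
    refine Tendsto.inv₀ (tendsto_const_nhds.sub (Tendsto.const_mul a ?_)) (by simp)
    refine ((tendsto_pow_atTop_nhds_zero_of_norm_lt_one hq).comp
      tendsto_toNat_atTop).congr' ?_
    filter_upwards [eventually_ge_atTop 0] with n hn
    lift n to ℕ using hn
    simp
  have hneg : Tendsto (fun n : ℤ ↦ (1 - a * q ^ n)⁻¹) atBot (nhds 0) := by
    have hk := (tendsto_pow_atTop_nhds_zero_of_norm_lt_one hq).comp
      (tendsto_toNat_atTop.comp tendsto_neg_atBot_atTop)
    have h := hk.div (hk.sub_const a) (by simpa using ha)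
    rw [zero_div] at h
    refine h.congr' ?_
    filter_upwards [eventually_le_atBot 0] with n hn
    obtain ⟨k, rfl⟩ := Int.exists_eq_neg_ofNat hn
    have hqk : q ^ k ≠ 0 := pow_ne_zero _ hq0
    have hd : 1 - a * (q ^ k)⁻¹ = (q ^ k - a) / q ^ k := by field_simp
    simp [hd]
  have hO : (fun n : ℤ ↦ (1 - a * q ^ n)⁻¹) =O[cofinite] (fun _ ↦ (1 : ℝ)) := by
    rw [Int.cofinite_eq]
    exact (hneg.isBigO_one ℝ).sup (hpos.isBigO_one ℝ)
  refine summable_of_isBigO hw.norm ?_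
  simpa [div_eq_mul_inv] using (Asymptotics.isBigO_refl w cofinite).norm_right.mul hO

/-- The elliptic transformation of the Lerch sum μ. -/
theorem lerchMu_elliptic (τ u v : ℂ) (hτ : 0 < τ.im)
    (hu : ∀ m n : ℤ, u ≠ (m : ℂ) * τ + (n : ℂ))
    (hv : ∀ m n : ℤ, v ≠ (m : ℂ) * τ + (n : ℂ)) :
    lerchMu u v τ + Complex.exp (-2 * π * I * (u - v) - π * I * τ) * lerchMu (u + τ) v τ
      = -I * Complex.exp (-π * I * (u - v) - π * I * τ / 4) := by
  have hJ : jacobiTheta₂ (v + 1 / 2 + τ / 2) τ ≠ 0 := by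
    refine jacobiTheta₂_ne_zero hτ fun m n h ↦ hv (m - 1) (n - 1) ?_
    push_cast
    linear_combination h
  rw [lerchMu_eq, lerchMu_eq]
  set w : ℤ → ℂ := fun n ↦ jacobiTheta₂_term n (v + 1 / 2 + τ / 2) τ
  set q := cexp (2 * π * I * τ)
  set a := cexp (2 * π * I * u) with ha
  set b := cexp (2 * π * I * v) with hb
  have hq0 : q ≠ 0 := Complex.exp_ne_zero _
  have ha0 : a ≠ 0 := Complex.exp_ne_zero _
  have hq : ‖q‖ < 1 := norm_exp_two_pi_I_mul_lt_one hτ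
  have hs : HasSum w (jacobiTheta₂ (v + 1 / 2 + τ / 2) τ) := hasSum_jacobiTheta₂_term _ hτ
  have haq : cexp (2 * π * I * (u + τ)) = a * q := by
    rw [mul_add, Complex.exp_add]
  have hD (n : ℤ) : 1 - a * q ^ n ≠ 0 := by
    rw [← Complex.exp_int_mul, ← Complex.exp_add, sub_ne_zero, ne_comm, Ne,
      Complex.exp_eq_one_iff]
    rintro ⟨k, hk⟩
    refine hu (-n) k (mul_left_cancel₀ Complex.two_pi_I_ne_zero ?_)
    push_cast
    linear_combination hk
  have hstep (n : ℤ) : w n = -(b * q ^ n) * w (n - 1) := by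
    have h := jacobiTheta₂_term_add_one (n - 1) (v + 1 / 2 + τ / 2) τ
    have hc : cexp (2 * π * I * (v + 1 / 2 + τ / 2) + π * I * τ) = -(b * q) := by
      rw [← mul_neg_one, ← Complex.exp_pi_mul_I, ← Complex.exp_add, ← Complex.exp_add]
      congr 1
      ring
    rw [sub_add_cancel, hc, zpow_sub_one₀ hq0] at h
    simp only [w, h]
    field_simp
  have h1 := (summable_div_one_sub_mul_zpow hq hq0 ha0 hs.summable).hasSum
  have h2 := (summable_div_one_sub_mul_zpow hq hq0 (mul_ne_zero ha0 hq0) hs.summable).hasSum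
  have h3 : HasSum (fun n ↦ b / a * w (n - 1)) (b / a * jacobiTheta₂ (v + 1 / 2 + τ / 2) τ) :=
    ((Equiv.subRight (1 : ℤ)).hasSum_iff.mpr hs).mul_left _
  have key := (h1.add (((Equiv.subRight (1 : ℤ)).hasSum_iff.mpr h2).mul_left (b / a))).unique
    (h3.congr_fun fun n ↦ by
      have := hD n
      simp only [Function.comp_apply, Equiv.subRight_apply, zpow_sub_one₀ hq0,
        mul_assoc a q, mul_comm q, inv_mul_cancel_right₀ hq0, hstep n]
      rw [show w (n - 1) = w (n - 1) * ((1 - a * q ^ n) / (1 - a * q ^ n)) by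
        rw [div_self this, mul_one]]
      field_simp
      ring)
  have he : cexp (-2 * π * I * (u - v) - π * I * τ) * cexp (π * I * (u + τ)) =
      cexp (π * I * u) * (b / a) := by
    rw [ha, hb, ← Complex.exp_sub, ← Complex.exp_add, ← Complex.exp_add]
    congr 1
    ring
  have hf : cexp (π * I * u) * (b / a) =
      cexp (-π * I * (u - v) - π * I * τ / 4) * cexp (π * I * τ / 4 + π * I * v) := by
    rw [ha, hb, ← Complex.exp_sub, ← Complex.exp_add, ← Complex.exp_add]
    congr 1
    ring
  change cexp (π * I * u) / jTheta v τ * ∑' n, w n / (1 - a * q ^ n) +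
    _ * (_ / jTheta v τ * ∑' n, w n / (1 - cexp (2 * π * I * (u + τ)) * q ^ n)) = _
  rw [haq]
  calc
    _ = cexp (π * I * u) / jTheta v τ *
        (∑' n, w n / (1 - a * q ^ n) + b / a * ∑' n, w n / (1 - a * q * q ^ n)) := by
      linear_combination (∑' n, w n / (1 - a * q * q ^ n)) / jTheta v τ * he
    _ = cexp (π * I * u) * (b / a) * (jacobiTheta₂ (v + 1 / 2 + τ / 2) τ / jTheta v τ) := by
      rw [key]
      ring
    _ = _ := by
      have := Complex.exp_ne_zero (π * I * τ / 4 + π * I * v)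
      rw [hf, jTheta_eq]
      generalize jacobiTheta₂ (v + 1 / 2 + τ / 2) τ = J at hJ ⊢
      field_simp
      simp

end
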